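/- arXiv:2312.03945 — 2 statements merged into one kernel-verified Lean document; each statement's English description precedes it below -/
import Mathlib

section
/- Define the doubly increasing function u on ℝ² by u(x,y) = (x+y)/|x−y| if xy ≤ 0 and (x,y) ≠ (0,0); u(x,y) = sgn(x+y) if xy > 0; u(0,0) = 0. If ũ : ℝ² → ℝ is any doubly increasing function satisfying (∂ũ/∂x)(∂ũ/∂y) ≥ (∂u/∂x)(∂u/∂y) at almost every point where both are differentiable, then ũ is discontinuous at the origin; more precisely, limsup_{ε→0⁺} (ũ(ε,0) − ũ(0,−ε)) ≥ π/2. -/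
/-- Partial derivative in the first coordinate. -/
noncomputable def pdx (v : ℝ × ℝ → ℝ) (p : ℝ × ℝ) : ℝ :=
  deriv (fun t => v (t, p.2)) p.1

/-- Partial derivative in the second coordinate. -/
noncomputable def pdy (v : ℝ × ℝ → ℝ) (p : ℝ × ℝ) : ℝ :=
  deriv (fun t => v (p.1, t)) p.2

/-- The function from the counterexample. -/
noncomputable def uEx (p : ℝ × ℝ) : ℝ :=
  if p.1 * p.2 ≤ 0 then
    (if p = (0, 0) then 0 else (p.1 + p.2) / |p.1 - p.2|)
  else Real.sign (p.1 + p.2)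

open MeasureTheory Filter Set Topology

/-- inf-convolution with a cone. -/
noncomputable def lowEnv (f : ℝ × ℝ → ℝ) (k : ℕ) (p : ℝ × ℝ) : ℝ := ⨅ q, (f q + k * ‖p - q‖)

lemma lowEnv_bdd {f : ℝ × ℝ → ℝ} {M : ℝ} (hf : ∀ p, |f p| ≤ M) (k : ℕ) (p : ℝ × ℝ) :
    BddBelow (range fun q => f q + k * ‖p - q‖) := by
  refine ⟨-M, ?_⟩
  rintro _ ⟨q, rfl⟩
  have := (abs_le.1 (hf q)).1
  have h2 : (0:ℝ) ≤ k * ‖p - q‖ := by positivity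
  simp only
  linarith

lemma lowEnv_le {f : ℝ × ℝ → ℝ} {M : ℝ} (hf : ∀ p, |f p| ≤ M) (k : ℕ) (p : ℝ × ℝ) :
    lowEnv f k p ≤ f p := by
  have := ciInf_le (lowEnv_bdd hf k p) p
  simpa [lowEnv] using this

lemma lowEnv_lip {f : ℝ × ℝ → ℝ} {M : ℝ} (hf : ∀ p, |f p| ≤ M) (k : ℕ) :
    LipschitzWith (k : NNReal) (lowEnv f k) := by
  apply LipschitzWith.of_le_add_mul
  intro x y
  rw [← sub_le_iff_le_add]
  apply le_ciInf
  intro q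
  have h1 : lowEnv f k x ≤ f q + k * ‖x - q‖ := ciInf_le (lowEnv_bdd hf k x) q
  have h2 : ‖x - q‖ ≤ dist x y + ‖y - q‖ := by
    rw [dist_eq_norm]
    have := norm_add_le (x - y) (y - q)
    simpa using this
  have h3 := mul_le_mul_of_nonneg_left h2 (Nat.cast_nonneg (α := ℝ) k)
  simp only [NNReal.coe_natCast]
  linarith

lemma lowEnv_eq {f : ℝ × ℝ → ℝ} {M : ℝ} (hf : ∀ p, |f p| ≤ M) {k : ℕ} {p : ℝ × ℝ}
    (h : ∀ q, |f q - f p| ≤ k * ‖q - p‖) : lowEnv f k p = f p := by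
  apply le_antisymm (lowEnv_le hf k p)
  apply le_ciInf
  intro q
  have := (abs_le.1 (h q)).1
  rw [norm_sub_rev] at this
  linarith

lemma squeeze_diff {f l u : ℝ × ℝ → ℝ} {p : ℝ × ℝ} (hl : DifferentiableAt ℝ l p)
    (hu : DifferentiableAt ℝ u p) (h1 : ∀ q, l q ≤ f q) (h2 : ∀ q, f q ≤ u q)
    (e1 : l p = f p) (e2 : u p = f p) : DifferentiableAt ℝ f p := by
  have hmin : IsLocalMin (fun q => u q - l q) p := by
    apply Filter.Eventually.of_forall
    intro q
    have := h1 q; have := h2 q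
    simp only [e1, e2]
    linarith
  have h0 := hmin.hasFDerivAt_eq_zero (hu.hasFDerivAt.sub hl.hasFDerivAt)
  have hd : fderiv ℝ u p = fderiv ℝ l p := sub_eq_zero.1 h0
  have H1 := hl.hasFDerivAt
  have H2 := hu.hasFDerivAt
  rw [hd] at H2
  refine ⟨fderiv ℝ l p, ?_⟩
  rw [hasFDerivAt_iff_isLittleO_nhds_zero] at *
  rw [Asymptotics.isLittleO_iff] at *
  intro c hc
  filter_upwards [H1 hc, H2 hc] with h a1 a2
  rw [Real.norm_eq_abs, abs_le] at *
  have := h1 (p + h); have := h2 (p + h)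
  constructor <;> linarith [a1.1, a2.2]

lemma bounded_stepanov {f : ℝ × ℝ → ℝ} {M : ℝ} (hf : ∀ p, |f p| ≤ M)
    (h : ∀ᵐ p : ℝ × ℝ, ∃ k : ℕ, ∀ q, |f q - f p| ≤ k * ‖q - p‖) :
    ∀ᵐ p : ℝ × ℝ, DifferentiableAt ℝ f p := by
  have hg : ∀ p, |(-f) p| ≤ M := fun p => by simpa using hf p
  have A : ∀ᵐ p : ℝ × ℝ, ∀ k : ℕ, DifferentiableAt ℝ (lowEnv f k) p :=
    ae_all_iff.2 fun k => (lowEnv_lip hf k).ae_differentiableAt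
  have B : ∀ᵐ p : ℝ × ℝ, ∀ k : ℕ, DifferentiableAt ℝ (lowEnv (-f) k) p :=
    ae_all_iff.2 fun k => (lowEnv_lip hg k).ae_differentiableAt
  filter_upwards [h, A, B] with p ⟨k, hk⟩ a b
  refine squeeze_diff (a k) (b k).neg (lowEnv_le hf k) ?_ (lowEnv_eq hf hk) ?_
  · intro q
    have := lowEnv_le hg k q
    simp only [Pi.neg_apply] at *
    linarith
  · have := lowEnv_eq hg (k := k) (p := p) (fun q => by
      have := hk q
      rw [abs_sub_comm] at this
      simpa [neg_add_eq_sub] using this)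
    simp [this]

lemma diag_le (q p : ℝ × ℝ) : q ≤ p + ‖q - p‖ • ((1, 1) : ℝ × ℝ) := by
  have h1 : |q.1 - p.1| ≤ ‖q - p‖ := norm_fst_le (q - p)
  have h2 : |q.2 - p.2| ≤ ‖q - p‖ := norm_snd_le (q - p)
  rw [abs_le] at h1 h2
  constructor <;> simp <;> linarith

lemma le_diag (q p : ℝ × ℝ) : p - ‖q - p‖ • ((1, 1) : ℝ × ℝ) ≤ q := by
  have h1 : |q.1 - p.1| ≤ ‖q - p‖ := norm_fst_le (q - p)
  have h2 : |q.2 - p.2| ≤ ‖q - p‖ := norm_snd_le (q - p)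
  rw [abs_le] at h1 h2
  constructor <;> simp <;> linarith

def goodSet (f : ℝ × ℝ → ℝ) (k : ℕ) : Set (ℝ × ℝ) :=
  {p | ∀ h : ℝ, 0 < h → f (p + h • ((1, 1) : ℝ × ℝ)) - f (p - h • ((1, 1) : ℝ × ℝ)) ≤ k * h}

lemma goodSet_closed {f : ℝ × ℝ → ℝ} (hm : Monotone f) (k : ℕ) : IsClosed (goodSet f k) := by
  rw [← closure_subset_iff_isClosed]
  intro p hp h hh
  rw [Metric.mem_closure_iff] at hp
  apply le_of_forall_pos_le_add
  intro e he
  obtain ⟨q, hq, hd⟩ := hp (e / (k + 1)) (by positivity)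
  set d := dist p q with hdd
  rw [dist_eq_norm] at hdd
  have hd0 : 0 ≤ d := by rw [hdd]; positivity
  have h1 := diag_le p q
  have h2 := le_diag p q
  rw [← hdd] at h1 h2
  have h3 := hq (h + d) (by linarith)
  have h4 : f (p + h • ((1, 1) : ℝ × ℝ)) ≤ f (q + (h + d) • ((1, 1) : ℝ × ℝ)) := by
    apply hm
    rw [add_smul, add_comm (h • _), ← add_assoc]
    gcongr
  have h5 : f (q - (h + d) • ((1, 1) : ℝ × ℝ)) ≤ f (p - h • ((1, 1) : ℝ × ℝ)) := by
    apply hm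
    rw [add_smul, add_comm (h • _), ← sub_sub]
    gcongr
  have h6 : (k + 1) * d ≤ e := by
    rw [lt_div_iff₀ (by positivity)] at hd
    linarith
  nlinarith

lemma line_good {f : ℝ → ℝ} {M : ℝ} (hf : ∀ p, |f p| ≤ M) {t : ℝ}
    (hd : DifferentiableAt ℝ f t) : ∃ k : ℕ, ∀ h : ℝ, 0 < h → f (t + h) - f (t - h) ≤ k * h := by
  obtain ⟨C, hC⟩ := hd.isBigO_sub.bound
  obtain ⟨d, hd0, hd⟩ := Metric.eventually_nhds_iff.1 hC
  obtain ⟨k, hk⟩ := exists_nat_ge (max (2 * C) (2 * M / d))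
  refine ⟨k, fun h hh => ?_⟩
  have hk1 := (le_max_left _ _).trans hk
  have hk2 := (le_max_right _ _).trans hk
  by_cases hlt : h < d
  · have a1 := hd (y := t + h) (by simp [abs_of_pos hh, hlt])
    have a2 := hd (y := t - h) (by simp [abs_of_pos hh, hlt])
    simp only [add_sub_cancel_left, sub_sub_cancel_left, norm_neg, Real.norm_eq_abs,
      abs_of_pos hh] at a1 a2
    have b1 := (abs_le.1 a1).2
    have b2 := (abs_le.1 a2).1
    nlinarith
  · have b1 := (abs_le.1 (hf (t + h))).2
    have b2 := (abs_le.1 (hf (t - h))).1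
    rw [div_le_iff₀ hd0] at hk2
    have : (k:ℝ) * d ≤ k * h := by gcongr; linarith
    linarith

lemma bounded_mono_diff {f : ℝ × ℝ → ℝ} {M : ℝ} (hf : ∀ p, |f p| ≤ M) (hm : Monotone f) :
    ∀ᵐ p : ℝ × ℝ, DifferentiableAt ℝ f p := by
  apply bounded_stepanov hf
  have key : ∀ᵐ p : ℝ × ℝ, p ∈ ⋃ k, goodSet f k := by
    refine ae_mem_of_ae_add_linearMap_mem
      (LinearMap.toSpanSingleton ℝ (ℝ × ℝ) ((1, 1) : ℝ × ℝ)) volume volume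
      (MeasurableSet.iUnion fun k => (goodSet_closed hm k).measurableSet) ?_
    intro y
    have hmono : Monotone (fun t : ℝ => f (y + t • ((1, 1) : ℝ × ℝ))) := by
      intro a b hab
      apply hm
      constructor <;> simp [hab]
    filter_upwards [hmono.ae_differentiableAt] with t ht
    obtain ⟨k, hk⟩ := line_good (M := M) (fun t => hf _) ht
    refine mem_iUnion.2 ⟨k, fun h hh => ?_⟩
    have := hk h hh
    simpa [add_smul, sub_smul, add_assoc, add_sub_assoc] using this
  filter_upwards [key] with p hp
  obtain ⟨k, hk⟩ := mem_iUnion.1 hp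
  refine ⟨k, fun q => ?_⟩
  rcases eq_or_ne q p with rfl | hne
  · simp
  have h0 : 0 < ‖q - p‖ := norm_pos_iff.2 (sub_ne_zero.2 hne)
  have a := hk _ h0
  have b1 := hm (diag_le q p)
  have b2 := hm (le_diag q p)
  have c1 : p ≤ p + ‖q - p‖ • ((1, 1) : ℝ × ℝ) := by constructor <;> simp
  have c2 : p - ‖q - p‖ • ((1, 1) : ℝ × ℝ) ≤ p := by constructor <;> simp
  have := hm c1
  have := hm c2
  rw [abs_le]
  constructor <;> linarith

/-- Burkill and Haslam Jones. -/
lemma mono_diff {f : ℝ × ℝ → ℝ} (hm : Monotone f) :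
    ∀ᵐ p : ℝ × ℝ, DifferentiableAt ℝ f p := by
  have A : ∀ᵐ p : ℝ × ℝ, ∀ n : ℕ,
      DifferentiableAt ℝ (fun q => max (-(n:ℝ)) (min n (f q))) p := by
    refine ae_all_iff.2 fun n => bounded_mono_diff (M := n) ?_ ?_
    · intro p
      have : (0:ℝ) ≤ n := by positivity
      rw [abs_le]
      refine ⟨le_max_left _ _, max_le (by linarith) (min_le_left _ _)⟩
    · intro a b hab
      exact max_le_max le_rfl (min_le_min le_rfl (hm hab))
  filter_upwards [A] with p hp
  obtain ⟨n, hn⟩ := exists_nat_gt |f p|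
  have hd := hp n
  rw [abs_lt] at hn
  have e : max (-(n:ℝ)) (min n (f p)) = f p := by
    rw [min_eq_right hn.2.le, max_eq_right hn.1.le]
  refine hd.congr_of_eventuallyEq ?_
  have t := hd.continuousAt.tendsto
  rw [e] at t
  filter_upwards [t.eventually (Ioo_mem_nhds hn.1 hn.2)] with q hq
  rcases le_total (n:ℝ) (f q) with h | h
  · rw [min_eq_left h] at hq
    have := hq.2
    rw [max_lt_iff] at this
    exact absurd this.2 (lt_irrefl _)
  · rw [min_eq_right h] at hq ⊢
    rcases le_total (f q) (-(n:ℝ)) with h' | h'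
    · rw [max_eq_left h'] at hq
      exact absurd hq.1 (lt_irrefl _)
    · rw [max_eq_right h']

lemma uEx_eq {p : ℝ × ℝ} (h1 : 0 < p.1) (h2 : p.2 < 0) :
    uEx p = (p.1 + p.2) / (p.1 - p.2) := by
  have h : p.1 * p.2 ≤ 0 := by nlinarith
  have hne : p ≠ (0, 0) := by
    rintro rfl
    simp at h1
  rw [uEx, if_pos h, if_neg hne, abs_of_pos (by linarith)]

lemma uEx_evt {p : ℝ × ℝ} (h1 : 0 < p.1) (h2 : p.2 < 0) :
    uEx =ᶠ[𝓝 p] fun q => (q.1 + q.2) / (q.1 - q.2) := by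
  filter_upwards [continuous_fst.continuousAt.eventually (lt_mem_nhds h1),
    continuous_snd.continuousAt.eventually (gt_mem_nhds h2)] with q a b
  exact uEx_eq a b

lemma uEx_diff {p : ℝ × ℝ} (h1 : 0 < p.1) (h2 : p.2 < 0) : DifferentiableAt ℝ uEx p := by
  refine DifferentiableAt.congr_of_eventuallyEq ?_ (uEx_evt h1 h2)
  have hne : p.1 - p.2 ≠ 0 := by linarith
  have a1 : DifferentiableAt ℝ (fun q : ℝ × ℝ => q.1 + q.2) p := by fun_prop
  have a2 : DifferentiableAt ℝ (fun q : ℝ × ℝ => q.1 - q.2) p := by fun_prop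
  have a3 := a1.mul (a2.inv hne)
  simp only [div_eq_mul_inv]
  exact a3

lemma uEx_pdx {p : ℝ × ℝ} (h1 : 0 < p.1) (h2 : p.2 < 0) :
    pdx uEx p = -2 * p.2 / (p.1 - p.2) ^ 2 := by
  have hne : p.1 - p.2 ≠ 0 := by linarith
  have e : (fun t => uEx (t, p.2)) =ᶠ[𝓝 p.1] fun t => (t + p.2) / (t - p.2) := by
    filter_upwards [lt_mem_nhds h1] with t ht
    exact uEx_eq (p := (t, p.2)) ht h2
  rw [pdx, e.deriv_eq]
  have := (((hasDerivAt_id p.1).add_const p.2).div ((hasDerivAt_id p.1).sub_const p.2) hne).deriv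
  refine Eq.trans this ?_
  simp only [id]
  congr 1
  ring

lemma uEx_pdy {p : ℝ × ℝ} (h1 : 0 < p.1) (h2 : p.2 < 0) :
    pdy uEx p = 2 * p.1 / (p.1 - p.2) ^ 2 := by
  have hne : p.1 - p.2 ≠ 0 := by linarith
  have e : (fun t => uEx (p.1, t)) =ᶠ[𝓝 p.2] fun t => (p.1 + t) / (p.1 - t) := by
    filter_upwards [gt_mem_nhds h2] with t ht
    exact uEx_eq (p := (p.1, t)) h1 ht
  rw [pdy, e.deriv_eq]
  have := (((hasDerivAt_id p.2).const_add p.1).div ((hasDerivAt_id p.2).const_sub p.1) hne).deriv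
  refine Eq.trans this ?_
  simp only [id]
  congr 1
  ring

lemma amgm {A B x s : ℝ} (hA : 0 ≤ A) (hB : 0 ≤ B) (hx : 0 < x) (hs : 0 < s)
    (h : (2 * s / (x + s) ^ 2) * (2 * x / (x + s) ^ 2) ≤ A * B) :
    4 * (x * s) / (x + s) ^ 2 ≤ A * x + B * s := by
  refine (sq_le_sq₀ (by positivity) (by positivity)).1 ?_
  have h1 : (4 * (x * s) / (x + s) ^ 2) ^ 2
      = 4 * (x * s) * ((2 * s / (x + s) ^ 2) * (2 * x / (x + s) ^ 2)) := by
    ring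
  have h2 : 4 * (x * s) * ((2 * s / (x + s) ^ 2) * (2 * x / (x + s) ^ 2)) ≤ 4 * (x * s) * (A * B) := by
    gcongr
  nlinarith [sq_nonneg (A * x - B * s)]

/-- Hyperbolic coordinates. -/
noncomputable def hyp (q : ℝ × ℝ) : ℝ × ℝ := (Real.exp (q.1 + q.2), -Real.exp (q.1 - q.2))

lemma ae_hyp {P : ℝ × ℝ → Prop} (h : ∀ᵐ p : ℝ × ℝ, P p) : ∀ᵐ q : ℝ × ℝ, P (hyp q) := by
  rw [ae_iff] at h ⊢
  let G : ℝ × ℝ → ℝ × ℝ := fun p =>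
    ((Real.log p.1 + Real.log (-p.2)) / 2, (Real.log p.1 - Real.log (-p.2)) / 2)
  let S : Set (ℝ × ℝ) := {p | ¬ P p} ∩ {p | 0 < p.1 ∧ p.2 < 0}
  have hS : volume S = 0 := measure_mono_null inter_subset_left h
  have hG : DifferentiableOn ℝ G S := by
    rintro p ⟨-, h1, h2⟩
    apply DifferentiableAt.differentiableWithinAt
    have a1 : DifferentiableAt ℝ (fun p : ℝ × ℝ => Real.log p.1) p :=
      differentiableAt_fst.log h1.ne'
    have a2 : DifferentiableAt ℝ (fun p : ℝ × ℝ => Real.log (-p.2)) p :=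
      differentiableAt_snd.neg.log (by simpa using h2.ne)
    have b1 : DifferentiableAt ℝ (fun p : ℝ × ℝ => (Real.log p.1 + Real.log (-p.2)) / 2) p := by
      simp only [div_eq_mul_inv]
      exact (a1.add a2).mul_const _
    have b2 : DifferentiableAt ℝ (fun p : ℝ × ℝ => (Real.log p.1 - Real.log (-p.2)) / 2) p := by
      simp only [div_eq_mul_inv]
      exact (a1.sub a2).mul_const _
    exact b1.prodMk b2
  have := addHaar_image_eq_zero_of_differentiableOn_of_addHaar_eq_zero volume hG hS
  refine measure_mono_null ?_ this
  intro q hq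
  refine ⟨hyp q, ⟨hq, Real.exp_pos _, neg_neg_of_pos (Real.exp_pos _)⟩, ?_⟩
  simp only [G, hyp, neg_neg, Real.log_exp]
  ext <;> simp

lemma curve_deriv {v : ℝ × ℝ → ℝ} (hv : Monotone v) {c t : ℝ}
    (hd : DifferentiableAt ℝ v (hyp (c, t)))
    (hp : pdx uEx (hyp (c, t)) * pdy uEx (hyp (c, t)) ≤ pdx v (hyp (c, t)) * pdy v (hyp (c, t))) :
    4 / (Real.exp t + Real.exp (-t)) ^ 2 ≤ deriv (fun t => v (hyp (c, t))) t := by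
  set p := hyp (c, t) with hpdef
  set x := Real.exp (c + t) with hx
  set s := Real.exp (c - t) with hs
  have hpe : p = (x, -s) := rfl
  have hx0 : 0 < x := Real.exp_pos _
  have hs0 : 0 < s := Real.exp_pos _
  have e1 : pdx v p = fderiv ℝ v p (1, 0) := by
    have h1 : HasDerivAt (fun t : ℝ => (t, p.2)) ((1, 0) : ℝ × ℝ) p.1 :=
      (hasDerivAt_id p.1).prodMk (hasDerivAt_const p.1 p.2)
    exact (HasFDerivAt.comp_hasDerivAt p.1 (f := fun t : ℝ => (t, p.2)) hd.hasFDerivAt h1).deriv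
  have e2 : pdy v p = fderiv ℝ v p (0, 1) := by
    have h1 : HasDerivAt (fun t : ℝ => (p.1, t)) ((0, 1) : ℝ × ℝ) p.2 :=
      (hasDerivAt_const p.2 p.1).prodMk (hasDerivAt_id p.2)
    exact (HasFDerivAt.comp_hasDerivAt p.2 (f := fun t : ℝ => (p.1, t)) hd.hasFDerivAt h1).deriv
  have hA : 0 ≤ pdx v p := by
    apply Monotone.deriv_nonneg
    intro a b hab
    exact hv ⟨hab, le_rfl⟩
  have hB : 0 ≤ pdy v p := by
    apply Monotone.deriv_nonneg
    intro a b hab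
    exact hv ⟨le_rfl, hab⟩
  have hcurve : HasDerivAt (fun t : ℝ => hyp (c, t)) ((x, s) : ℝ × ℝ) t := by
    have a1 : HasDerivAt (fun t : ℝ => Real.exp (c + t)) x t := by
      simpa using ((hasDerivAt_id t).const_add c).exp
    have a2 : HasDerivAt (fun t : ℝ => -Real.exp (c - t)) s t := by
      have a3 := ((hasDerivAt_id t).const_sub c).exp.neg
      simp only [id, mul_neg, mul_one, neg_neg] at a3
      exact a3
    exact a1.prodMk a2
  have hder : deriv (fun t => v (hyp (c, t))) t = pdx v p * x + pdy v p * s := by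
    have := (HasFDerivAt.comp_hasDerivAt t (f := fun t : ℝ => hyp (c, t)) hd.hasFDerivAt hcurve).deriv
    refine Eq.trans this ?_
    have e3 : ((x, s) : ℝ × ℝ) = x • ((1, 0) : ℝ × ℝ) + s • ((0, 1) : ℝ × ℝ) := by simp
    rw [e3, map_add, map_smul, map_smul, e1, e2]
    simp only [smul_eq_mul]
    ring
  rw [hder]
  have hp2 : p.2 < 0 := by rw [hpe]; simpa using hs0
  have hp1 : 0 < p.1 := hx0
  rw [uEx_pdx hp1 hp2, uEx_pdy hp1 hp2] at hp
  have := amgm hA hB hx0 hs0 (by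
    refine le_trans (le_of_eq ?_) hp
    rw [hpe]
    simp)
  refine le_trans (le_of_eq ?_) this
  have f1 : x = Real.exp c * Real.exp t := Real.exp_add _ _
  have f2 : s = Real.exp c * Real.exp (-t) := by rw [← Real.exp_add]; rfl
  have f3 : x * s = Real.exp c ^ 2 := by
    rw [f1, f2, Real.exp_neg]
    have := (Real.exp_pos t).ne'
    field_simp
  rw [f3, f1, f2, ← mul_add, mul_pow]
  have := (Real.exp_pos c).ne'
  have : Real.exp t + Real.exp (-t) ≠ 0 := by positivity
  field_simp

lemma F_deriv (t : ℝ) : HasDerivAt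
    (fun t => (Real.exp t - Real.exp (-t)) / (Real.exp t + Real.exp (-t)))
    (4 / (Real.exp t + Real.exp (-t)) ^ 2) t := by
  have a1 := Real.hasDerivAt_exp t
  have a2 : HasDerivAt (fun t : ℝ => Real.exp (-t)) (-Real.exp (-t)) t := by
    have a3 := (hasDerivAt_id t).neg.exp
    simp only [Pi.neg_apply, id, mul_neg, mul_one] at a3
    exact a3
  have h0 : Real.exp t + Real.exp (-t) ≠ 0 := by positivity
  refine ((a1.sub a2).div (a1.add a2) h0).congr_deriv ?_
  simp only [Pi.add_apply, Pi.sub_apply]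
  congr 1
  have : Real.exp t * Real.exp (-t) = 1 := by rw [← Real.exp_add]; simp
  linear_combination 4 * this

lemma curve_gap {v : ℝ × ℝ → ℝ} (hv : Monotone v) {c : ℝ}
    (h : ∀ᵐ t : ℝ, 4 / (Real.exp t + Real.exp (-t)) ^ 2 ≤ deriv (fun t => v (hyp (c, t))) t) :
    8 / 5 ≤ v (hyp (c, Real.log 3)) - v (hyp (c, -Real.log 3)) := by
  have hm : Monotone (fun t => v (hyp (c, t))) := by
    intro a b hab
    apply hv
    constructor
    · simp [hyp, hab]
    · simp only [hyp, neg_le_neg_iff, Real.exp_le_exp]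
      linarith
  have hl : 0 < Real.log 3 := Real.log_pos (by norm_num)
  have hab : -Real.log 3 ≤ Real.log 3 := by linarith
  have hM := hm.monotoneOn (uIcc (-Real.log 3) (Real.log 3))
  have i1 := hM.intervalIntegral_deriv_mem_uIcc
  have hle := hm hab
  simp only at hle
  rw [uIcc_of_le (by linarith)] at i1
  have hc : Continuous (fun t : ℝ => 4 / (Real.exp t + Real.exp (-t)) ^ 2) := by
    apply Continuous.div (by fun_prop) (by fun_prop)
    intro t
    positivity
  have i2 := intervalIntegral.integral_eq_sub_of_hasDerivAt (a := -Real.log 3) (b := Real.log 3)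
    (fun t _ => F_deriv t) (hc.intervalIntegrable _ _)
  have i3 := intervalIntegral.integral_mono_ae hab (hc.intervalIntegrable _ _)
    hM.intervalIntegrable_deriv h
  rw [i2] at i3
  have e3 : Real.exp (Real.log 3) = 3 := Real.exp_log (by norm_num)
  have e4 : Real.exp (-Real.log 3) = 1 / 3 := by rw [Real.exp_neg, e3]; norm_num
  rw [neg_neg, e3, e4] at i3
  have := i1.2
  norm_num at i3
  linarith

theorem stmt_6 (v : ℝ × ℝ → ℝ) (hv : Monotone v)
    (hprod : ∀ᵐ p : ℝ × ℝ ∂(MeasureTheory.volume),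
      DifferentiableAt ℝ v p → DifferentiableAt ℝ uEx p →
        pdx uEx p * pdy uEx p ≤ pdx v p * pdy v p) :
    Real.pi / 2 ≤
      Filter.limsup (fun ε : ℝ => v (ε, 0) - v (0, -ε)) (nhdsWithin 0 (Set.Ioi 0)) := by
  have h1 : ∀ᵐ p : ℝ × ℝ, DifferentiableAt ℝ v p ∧ (DifferentiableAt ℝ uEx p →
      pdx uEx p * pdy uEx p ≤ pdx v p * pdy v p) := by
    filter_upwards [hprod, mono_diff hv] with p a b
    exact ⟨b, a b⟩
  have h2 := ae_hyp h1
  have h3 : ∀ᵐ c : ℝ, ∀ᵐ t : ℝ,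
      4 / (Real.exp t + Real.exp (-t)) ^ 2 ≤ deriv (fun t => v (hyp (c, t))) t := by
    rw [Measure.volume_eq_prod] at h2
    filter_upwards [Measure.ae_ae_of_ae_prod h2] with c hc
    filter_upwards [hc] with t ht
    exact curve_deriv hv ht.1 (ht.2 (uEx_diff (Real.exp_pos _)
      (neg_neg_of_pos (Real.exp_pos _))))
  have key : ∀ ε : ℝ, 0 < ε → Real.pi / 2 ≤ v (ε, 0) - v (0, -ε) := by
    intro ε hε
    obtain ⟨c, hcm, hc⟩ : ∃ c, c ∈ Iio (Real.log ε - Real.log 3) ∧ ∀ᵐ t : ℝ,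
        4 / (Real.exp t + Real.exp (-t)) ^ 2 ≤ deriv (fun t => v (hyp (c, t))) t := by
      by_contra hcon
      have hz : volume (Iio (Real.log ε - Real.log 3)) = 0 :=
        measure_mono_null (fun c hc hc' => hcon ⟨c, hc, hc'⟩) (ae_iff.1 h3)
      simp at hz
    have hg := curve_gap hv hc
    have hb : Real.exp (c + Real.log 3) ≤ ε := by
      rw [← Real.le_log_iff_exp_le hε]
      have : c < Real.log ε - Real.log 3 := hcm
      linarith
    have a1 : v (hyp (c, Real.log 3)) ≤ v (ε, 0) := by
      apply hv
      exact ⟨hb, (neg_neg_of_pos (Real.exp_pos _)).le⟩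
    have a2 : v (0, -ε) ≤ v (hyp (c, -Real.log 3)) := by
      apply hv
      refine ⟨(Real.exp_pos _).le, ?_⟩
      simpa [hyp] using hb
    have := Real.pi_lt_d2
    linarith
  have hev : ∀ᶠ ε : ℝ in nhdsWithin 0 (Ioi 0), Real.pi / 2 ≤ v (ε, 0) - v (0, -ε) := by
    filter_upwards [self_mem_nhdsWithin] with ε hε
    exact key ε hε
  refine le_limsup_of_frequently_le hev.frequently ?_
  refine ⟨v (1, 0) - v (0, -1), ?_⟩
  rw [eventually_map]
  filter_upwards [Ioo_mem_nhdsGT (zero_lt_one (α := ℝ))] with ε hε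
  have a1 : v (ε, 0) ≤ v (1, 0) := hv ⟨hε.2.le, le_rfl⟩
  have a2 : v (0, -1) ≤ v (0, -ε) := hv ⟨le_rfl, by simpa using hε.2.le⟩
  linarith
end

section
/- Let u ∈ U, a > 0, and define ũ as in the two-step sup-inf construction: ũ(x,y) := inf_{z≥0} sup_{p>0} inf { z + p(x−x') + (a/p)(y−y') : 0 ≤ x' ≤ x, 0 ≤ y' ≤ y, u(x',y') ≤ z }. Then for all 0 ≤ x' ≤ x and 0 ≤ y' ≤ y, ũ(x,y) − ũ(x',y') ≤ √(a(y(x−x') + x(y−y'))). In particular ũ is continuous on ℝ≥0². -/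
open Set

/-- `u` belongs to the class `U`: doubly increasing on the nonnegative quadrant,
nonnegative there, and vanishing on the coordinate axes. -/
def MemU (u : ℝ × ℝ → ℝ) : Prop :=
  (∀ p q : ℝ × ℝ, 0 ≤ p.1 → 0 ≤ p.2 → p.1 ≤ q.1 → p.2 ≤ q.2 → u p ≤ u q) ∧
  (∀ p : ℝ × ℝ, 0 ≤ p.1 → 0 ≤ p.2 → 0 ≤ u p) ∧
  (∀ t : ℝ, 0 ≤ t → u (0, t) = 0 ∧ u (t, 0) = 0)

/-- The regularization `ũ_{z,p}(x,y)`. -/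
noncomputable def tzp (u : ℝ × ℝ → ℝ) (a z p x y : ℝ) : ℝ :=
  sInf ((fun q : ℝ × ℝ => z + p * (x - q.1) + (a / p) * (y - q.2)) ''
    {q : ℝ × ℝ | 0 ≤ q.1 ∧ q.1 ≤ x ∧ 0 ≤ q.2 ∧ q.2 ≤ y ∧ u q ≤ z})

/-- The regularization `ũ_z(x,y) = sup_{p>0} ũ_{z,p}(x,y)`. -/
noncomputable def tz (u : ℝ × ℝ → ℝ) (a z x y : ℝ) : ℝ :=
  sSup ((fun p => tzp u a z p x y) '' Ioi 0)

/-- The regularization `ũ(x,y) = inf_{z≥0} ũ_z(x,y)`. -/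
noncomputable def tu (u : ℝ × ℝ → ℝ) (a x y : ℝ) : ℝ :=
  sInf ((fun z => tz u a z x y) '' Ici 0)

section helpers
variable {u : ℝ × ℝ → ℝ} {a : ℝ}

lemma tzp_bdd (ha : 0 < a) {z p x y : ℝ} (hp : 0 < p) :
    z ∈ lowerBounds ((fun q : ℝ × ℝ => z + p * (x - q.1) + (a / p) * (y - q.2)) ''
    {q : ℝ × ℝ | 0 ≤ q.1 ∧ q.1 ≤ x ∧ 0 ≤ q.2 ∧ q.2 ≤ y ∧ u q ≤ z}) := by
  rintro _ ⟨q, ⟨h1, h2, h3, h4, h5⟩, rfl⟩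
  have e1 : 0 ≤ p * (x - q.1) := mul_nonneg hp.le (by linarith)
  have e2 : 0 ≤ (a / p) * (y - q.2) := mul_nonneg (by positivity) (by linarith)
  show z ≤ z + p * (x - q.1) + (a / p) * (y - q.2)
  linarith

lemma tzp_le (ha : 0 < a) {z p x y : ℝ} (hp : 0 < p) (q : ℝ × ℝ)
    (h : 0 ≤ q.1 ∧ q.1 ≤ x ∧ 0 ≤ q.2 ∧ q.2 ≤ y ∧ u q ≤ z) :
    tzp u a z p x y ≤ z + p * (x - q.1) + (a / p) * (y - q.2) :=
  csInf_le ⟨z, tzp_bdd ha hp⟩ ⟨q, h, rfl⟩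

lemma le_tzp (hu : MemU u) {z p x y c : ℝ} (hz : 0 ≤ z) (hx : 0 ≤ x) (hy : 0 ≤ y)
    (h : ∀ q : ℝ × ℝ, 0 ≤ q.1 → q.1 ≤ x → 0 ≤ q.2 → q.2 ≤ y → u q ≤ z →
      c ≤ z + p * (x - q.1) + (a / p) * (y - q.2)) : c ≤ tzp u a z p x y := by
  refine le_csInf ⟨_, (0, 0), ⟨le_rfl, hx, le_rfl, hy, ?_⟩, rfl⟩ ?_
  · rw [(hu.2.2 0 le_rfl).1]; exact hz
  · rintro _ ⟨q, ⟨h1, h2, h3, h4, h5⟩, rfl⟩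
    exact h q h1 h2 h3 h4 h5

lemma z_le_tzp (hu : MemU u) (ha : 0 < a) {z p x y : ℝ} (hz : 0 ≤ z) (hx : 0 ≤ x) (hy : 0 ≤ y)
    (hp : 0 < p) : z ≤ tzp u a z p x y :=
  le_tzp hu hz hx hy fun q h1 h2 h3 h4 h5 => tzp_bdd (u := u) ha hp ⟨q, ⟨h1, h2, h3, h4, h5⟩, rfl⟩

lemma tzp_le1 (hu : MemU u) (ha : 0 < a) {z p x y : ℝ} (hz : 0 ≤ z) (hx : 0 ≤ x) (hy : 0 ≤ y)
    (hp : 0 < p) : tzp u a z p x y ≤ z + p * x := by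
  have := tzp_le (u := u) (z := z) (x := x) (y := y) ha hp (0, y)
    ⟨le_rfl, hx, hy, le_rfl, by rw [(hu.2.2 y hy).1]; exact hz⟩
  simpa using this

lemma tzp_le2 (hu : MemU u) (ha : 0 < a) {z p x y : ℝ} (hz : 0 ≤ z) (hx : 0 ≤ x) (hy : 0 ≤ y)
    (hp : 0 < p) : tzp u a z p x y ≤ z + (a / p) * y := by
  have := tzp_le (u := u) (z := z) (x := x) (y := y) ha hp (x, 0)
    ⟨hx, le_rfl, le_rfl, hy, by rw [(hu.2.2 x hx).2]; exact hz⟩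
  simpa using this

lemma tzp_le_tz (hu : MemU u) (ha : 0 < a) {z p x y : ℝ} (hz : 0 ≤ z) (hx : 0 ≤ x) (hy : 0 ≤ y)
    (hp : 0 < p) : tzp u a z p x y ≤ tz u a z x y := by
  refine le_csSup ⟨z + x + a * y, ?_⟩ ⟨p, hp, rfl⟩
  rintro _ ⟨r, hr, rfl⟩
  have hr : 0 < r := hr
  show tzp u a z r x y ≤ _
  have hay : 0 ≤ a * y := by positivity
  rcases le_total r 1 with h | h
  · have := tzp_le1 hu ha hz hx hy hr
    nlinarith
  · have := tzp_le2 hu ha hz hx hy hr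
    have h2 : a / r * y ≤ a * y := mul_le_mul_of_nonneg_right (div_le_self ha.le h) hy
    linarith

lemma tz_le {z x y c : ℝ} (h : ∀ p, 0 < p → tzp u a z p x y ≤ c) : tz u a z x y ≤ c := by
  refine csSup_le ⟨_, 1, (one_pos : (0:ℝ) < 1), rfl⟩ ?_
  rintro _ ⟨r, hr, rfl⟩
  exact h r hr

lemma tu_le (hu : MemU u) (ha : 0 < a) {z x y : ℝ} (hz : 0 ≤ z) (hx : 0 ≤ x) (hy : 0 ≤ y) :
    tu u a x y ≤ tz u a z x y := by
  refine csInf_le ⟨0, ?_⟩ ⟨z, hz, rfl⟩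
  rintro _ ⟨r, hr, rfl⟩
  have hr : 0 ≤ r := hr
  exact hr.trans ((z_le_tzp hu ha hr hx hy one_pos).trans (tzp_le_tz hu ha hr hx hy one_pos))

lemma le_tu {x y c : ℝ} (h : ∀ z, 0 ≤ z → c ≤ tz u a z x y) : c ≤ tu u a x y := by
  refine le_csInf ⟨_, 0, (le_rfl : (0:ℝ) ≤ 0), rfl⟩ ?_
  rintro _ ⟨r, hr, rfl⟩
  exact h r hr

lemma tu_mono (hu : MemU u) (ha : 0 < a) {x y x' y' : ℝ} (hx' : 0 ≤ x') (hx : x' ≤ x)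
    (hy' : 0 ≤ y') (hy : y' ≤ y) : tu u a x' y' ≤ tu u a x y := by
  refine le_tu fun z hz => (tu_le hu ha hz hx' hy').trans (tz_le fun p hp => ?_)
  refine le_trans ?_ (tzp_le_tz hu ha hz (hx'.trans hx) (hy'.trans hy) hp)
  refine le_tzp hu hz (hx'.trans hx) (hy'.trans hy) fun q h1 h2 h3 h4 h5 => ?_
  refine (tzp_le ha hp (min q.1 x', min q.2 y') ⟨le_min h1 hx', min_le_right _ _, le_min h3 hy',
    min_le_right _ _, (hu.1 _ q (le_min h1 hx') (le_min h3 hy') (min_le_left _ _)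
      (min_le_left _ _)).trans h5⟩).trans ?_
  have e1 : x' - min q.1 x' ≤ x - q.1 := by
    rcases min_cases q.1 x' with h | h <;> linarith
  have e2 : y' - min q.2 y' ≤ y - q.2 := by
    rcases min_cases q.2 y' with h | h <;> linarith
  have := mul_le_mul_of_nonneg_left e1 hp.le
  have := mul_le_mul_of_nonneg_left e2 (by positivity : 0 ≤ a / p)
  dsimp only
  linarith

lemma tu_sub_le (hu : MemU u) (ha : 0 < a) {x y x' y' : ℝ} (hx' : 0 ≤ x') (hx : x' ≤ x)
    (hy' : 0 ≤ y') (hy : y' ≤ y) :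
    tu u a x y - tu u a x' y' ≤ Real.sqrt (a * (y * (x - x') + x * (y - y'))) := by
  have hx0 := hx'.trans hx
  have hy0 := hy'.trans hy
  suffices h : tu u a x y - Real.sqrt (a * (y * (x - x') + x * (y - y'))) ≤ tu u a x' y' by
    linarith
  refine le_tu fun z hz => ?_
  suffices h : tz u a z x y ≤ tz u a z x' y' + Real.sqrt (a * (y * (x - x') + x * (y - y'))) by
    linarith [tu_le hu ha hz hx0 hy0]
  refine tz_le fun p hp => ?_
  have k := tzp_le_tz hu ha hz hx' hy' hp
  have k0 := z_le_tzp hu ha hz hx' hy' hp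
  have k1 := tzp_le1 hu ha hz hx0 hy0 hp
  have k2 := tzp_le2 hu ha hz hx0 hy0 hp
  have k3 : tzp u a z p x y - p * (x - x') - (a / p) * (y - y') ≤ tzp u a z p x' y' := by
    refine le_tzp hu hz hx' hy' fun q h1 h2 h3 h4 h5 => ?_
    have := tzp_le (x := x) (y := y) ha hp q ⟨h1, h2.trans hx, h3, h4.trans hy, h5⟩
    linarith
  set m := tzp u a z p x y - tz u a z x' y' with hm
  suffices h : m ≤ Real.sqrt (a * (y * (x - x') + x * (y - y'))) by linarith
  rcases le_total m 0 with h0 | h0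
  · exact h0.trans (Real.sqrt_nonneg _)
  apply Real.le_sqrt_of_sq_le
  have m1 : m ≤ p * x := by linarith
  have m2 : m ≤ a / p * y := by linarith
  have m3 : m ≤ p * (x - x') + a / p * (y - y') := by linarith
  have d1 : 0 ≤ p * (x - x') := mul_nonneg hp.le (by linarith)
  have d2 : 0 ≤ a / p * (y - y') := mul_nonneg (by positivity) (by linarith)
  calc m ^ 2 = m * m := by ring
    _ ≤ m * (p * (x - x') + a / p * (y - y')) := mul_le_mul_of_nonneg_left m3 h0
    _ = m * (p * (x - x')) + m * (a / p * (y - y')) := by ring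
    _ ≤ (a / p * y) * (p * (x - x')) + (p * x) * (a / p * (y - y')) :=
      add_le_add (mul_le_mul_of_nonneg_right m2 d1) (mul_le_mul_of_nonneg_right m1 d2)
    _ = a * (y * (x - x') + x * (y - y')) := by field_simp

end helpers

theorem stmt_11 (u : ℝ × ℝ → ℝ) (hu : MemU u) (a : ℝ) (ha : 0 < a) :
    (∀ x y x' y' : ℝ, 0 ≤ x' → x' ≤ x → 0 ≤ y' → y' ≤ y →
      tu u a x y - tu u a x' y' ≤ Real.sqrt (a * (y * (x - x') + x * (y - y')))) ∧
    ContinuousOn (fun q : ℝ × ℝ => tu u a q.1 q.2) {q : ℝ × ℝ | 0 ≤ q.1 ∧ 0 ≤ q.2} := by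
  refine ⟨fun x y x' y' h1 h2 h3 h4 => tu_sub_le hu ha h1 h2 h3 h4, ?_⟩
  intro q0 hq0
  have hq0 : 0 ≤ q0.1 ∧ 0 ≤ q0.2 := hq0
  let F : ℝ × ℝ → ℝ := fun q => Real.sqrt (a * (max q.2 q0.2 * (max q.1 q0.1 - min q.1 q0.1) +
    max q.1 q0.1 * (max q.2 q0.2 - min q.2 q0.2)))
  have hF : Continuous F := by fun_prop
  have hF0 : F q0 = 0 := by simp [F]
  have hT : Filter.Tendsto F (nhdsWithin q0 {q : ℝ × ℝ | 0 ≤ q.1 ∧ 0 ≤ q.2}) (nhds 0) := by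
    rw [← hF0]; exact hF.continuousWithinAt
  refine tendsto_iff_dist_tendsto_zero.2 (squeeze_zero' (Filter.Eventually.of_forall
    fun _ => dist_nonneg) ?_ hT)
  filter_upwards [self_mem_nhdsWithin] with q hq
  have hq : 0 ≤ q.1 ∧ 0 ≤ q.2 := hq
  have n1 := le_min hq.1 hq0.1
  have n2 := le_min hq.2 hq0.2
  have A := tu_sub_le hu ha n1 (min_le_max : min q.1 q0.1 ≤ max q.1 q0.1) n2
    (min_le_max : min q.2 q0.2 ≤ max q.2 q0.2)
  have B1 := tu_mono hu ha n1 (min_le_left q.1 q0.1) n2 (min_le_left q.2 q0.2)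
  have B2 := tu_mono hu ha n1 (min_le_right q.1 q0.1) n2 (min_le_right q.2 q0.2)
  have B3 := tu_mono hu ha hq.1 (le_max_left q.1 q0.1) hq.2 (le_max_left q.2 q0.2)
  have B4 := tu_mono hu ha hq0.1 (le_max_right q.1 q0.1) hq0.2 (le_max_right q.2 q0.2)
  rw [Real.dist_eq, abs_le]
  constructor <;> simp only [F] <;> linarith
end
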